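/- arXiv:nlin/0510013 — 2 statements merged into one kernel-verified Lean document; each statement's English description precedes it below -/
import Mathlib

section
/- Suppose the family Ω satisfies the truncated Whitham hierarchy equations at every point. Then for every index A ∈ Fin n, every point q, and every vector v = (v.1, v.2) ∈ ℂ × (Fin n → ℂ), the contraction of the coordinate vector e_A (unit vector in the t A direction) with the Whitham 2-form is given by Π_q(e_A, v) = ∑_{B ∈ Fin n} (∂_p Ω_A · ∂_x Ω_B − ∂_x Ω_A · ∂_p Ω_B)(q) · (v.2 B) − (∂_p Ω_A)(q) · v.1. -/
open scoped BigOperators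

noncomputable section

/-- Partial derivative in the `p`-direction on `ℂ × (Fin n → ℂ)`. -/
def pDeriv {n : ℕ} (f : ℂ × (Fin n → ℂ) → ℂ) (q : ℂ × (Fin n → ℂ)) : ℂ :=
  fderiv ℂ f q (1, 0)

/-- Partial derivative in the `t A`-direction on `ℂ × (Fin n → ℂ)`. -/
def tDeriv {n : ℕ} (A : Fin n) (f : ℂ × (Fin n → ℂ) → ℂ) (q : ℂ × (Fin n → ℂ)) : ℂ :=
  fderiv ℂ f q (0, Pi.single A 1)

/-- The Whitham 2-form `Π = ∑_A δΩ_A ∧ dt_A` evaluated at `q` on a pair of vectors. -/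
def whithamForm {n : ℕ} (Ω : Fin n → ℂ × (Fin n → ℂ) → ℂ)
    (q u v : ℂ × (Fin n → ℂ)) : ℂ :=
  ∑ A : Fin n, (fderiv ℂ (Ω A) q u * v.2 A - fderiv ℂ (Ω A) q v * u.2 A)

/-- The Fréchet derivative on `ℂ × (Fin n → ℂ)` expanded in partial derivatives. -/
theorem fderiv_eq_pDeriv_add_sum_tDeriv {n : ℕ} (f : ℂ × (Fin n → ℂ) → ℂ)
    (q v : ℂ × (Fin n → ℂ)) :
    fderiv ℂ f q v = pDeriv f q * v.1 + ∑ B, tDeriv B f q * v.2 B := by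
  have hv : v = v.1 • ((1 : ℂ), (0 : Fin n → ℂ))
      + ∑ B, v.2 B • ((0 : ℂ), (Pi.single B 1 : Fin n → ℂ)) := by
    ext i
    · simp [Prod.fst_sum]
    · simp [Prod.snd_sum, Finset.sum_apply, Pi.single_apply]
  conv_lhs => rw [hv]
  simp only [map_add, map_sum, map_smul, smul_eq_mul, pDeriv, tDeriv, mul_comm]

/-- The contraction `∂_A ⌟ Π` of the coordinate vector `e_A` with the Whitham 2-form,
assuming the truncated Whitham hierarchy equations hold. -/
theorem whitham_contraction {n : ℕ} (hn : 0 < n)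
    (Ω : Fin n → ℂ × (Fin n → ℂ) → ℂ)
    (hdiff : ∀ A, Differentiable ℂ (Ω A))
    (hΩ0 : Ω ⟨0, hn⟩ = fun q => q.1)
    (hW : ∀ A B : Fin n, ∀ q : ℂ × (Fin n → ℂ),
      tDeriv A (Ω B) q - tDeriv B (Ω A) q +
        (tDeriv ⟨0, hn⟩ (Ω A) q * pDeriv (Ω B) q
          - pDeriv (Ω A) q * tDeriv ⟨0, hn⟩ (Ω B) q) = 0)
    (A : Fin n) (q v : ℂ × (Fin n → ℂ)) :
    whithamForm Ω q (((0 : ℂ), Pi.single A (1 : ℂ)) : ℂ × (Fin n → ℂ)) v =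
      (∑ B : Fin n,
        (pDeriv (Ω A) q * tDeriv ⟨0, hn⟩ (Ω B) q
          - tDeriv ⟨0, hn⟩ (Ω A) q * pDeriv (Ω B) q) * v.2 B)
        - pDeriv (Ω A) q * v.1 := by
  have hA : fderiv ℂ (Ω A) q v = pDeriv (Ω A) q * v.1 + ∑ B, tDeriv B (Ω A) q * v.2 B :=
    fderiv_eq_pDeriv_add_sum_tDeriv (Ω A) q v
  have hL : whithamForm Ω q ((0 : ℂ), Pi.single A (1 : ℂ)) v
      = ∑ B, tDeriv A (Ω B) q * v.2 B - fderiv ℂ (Ω A) q v := by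
    simp [whithamForm, tDeriv, Finset.sum_sub_distrib, Pi.single_apply]
  rw [hL, hA, add_comm, ← sub_sub, ← Finset.sum_sub_distrib]
  congr 1
  refine Finset.sum_congr rfl fun B _ => ?_
  linear_combination v.2 B * hW A B q
end
end

section
/- Let Ω_A, Ω_B, E, Q : ℂ × (Fin n → ℂ) → ℂ be twice continuously differentiable. Suppose both E and Q satisfy the Lax-type equations ∂_C F = ∂_p Ω_C · ∂_x F − ∂_x Ω_C · ∂_p F (F = E, Q; C = A, B) at every point, and suppose the string equation ∂_p Q · ∂_x E − ∂_x Q · ∂_p E = 1 holds at every point. Define W_{AB} := ∂_A Ω_B − ∂_B Ω_A + ∂_x Ω_A · ∂_p Ω_B − ∂_p Ω_A · ∂_x Ω_B. Then W_{AB} is constant in the (p, x)-directions: ∂_p W_{AB} = 0 and ∂_x W_{AB} = 0 at every point. -/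
open scoped BigOperators

noncomputable section

section DirectionalDerivatives

variable {V : Type*} [NormedAddCommGroup V] [NormedSpace ℂ V]

theorem ContDiff.differentiable_fderiv_apply_const {f : V → ℂ} (hf : ContDiff ℂ 2 f) (v : V) :
    Differentiable ℂ (fun r => fderiv ℂ f r v) :=
  ((hf.fderiv_right (m := 1) (by norm_num)).clm_apply contDiff_const).differentiable (by norm_num)

/-- Mixed second directional derivatives of a `C²` function commute. -/
theorem ContDiff.fderiv_fderiv_apply_comm {f : V → ℂ} (hf : ContDiff ℂ 2 f) (v w q : V) :
    fderiv ℂ (fun r => fderiv ℂ f r v) q w = fderiv ℂ (fun r => fderiv ℂ f r w) q v := by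
  have hd : DifferentiableAt ℂ (fderiv ℂ f) q :=
    (hf.fderiv_right (m := 1) (by norm_num)).differentiable (by norm_num) q
  have hs : IsSymmSndFDerivAt ℂ f q := hf.contDiffAt.isSymmSndFDerivAt (by simp)
  rw [fderiv_clm_apply hd (differentiableAt_const v), fderiv_clm_apply hd (differentiableAt_const w)]
  simpa using hs.eq w v

/-- The directional derivative of the bracket `∂_p f · ∂_x g - ∂_x f · ∂_p g`. -/
theorem fderiv_bracket_apply {f g : V → ℂ} (hf : ContDiff ℂ 2 f) (hg : ContDiff ℂ 2 g)
    (p x q w : V) :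
    fderiv ℂ (fun r => fderiv ℂ f r p * fderiv ℂ g r x - fderiv ℂ f r x * fderiv ℂ g r p) q w =
      fderiv ℂ f q p * fderiv ℂ (fun r => fderiv ℂ g r x) q w
        + fderiv ℂ g q x * fderiv ℂ (fun r => fderiv ℂ f r p) q w
        - (fderiv ℂ f q x * fderiv ℂ (fun r => fderiv ℂ g r p) q w
          + fderiv ℂ g q p * fderiv ℂ (fun r => fderiv ℂ f r x) q w) := by
  have hf' := fun v => hf.differentiable_fderiv_apply_const v q
  have hg' := fun v => hg.differentiable_fderiv_apply_const v q
  rw [fderiv_fun_sub ((hf' p).fun_mul (hg' x)) ((hf' x).fun_mul (hg' p)),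
    fderiv_fun_mul (hf' p) (hg' x), fderiv_fun_mul (hf' x) (hg' p)]
  simp

/-- The directional derivative of the zero-curvature expression of `f` and `g`. -/
theorem fderiv_curvature_apply {f g : V → ℂ} (hf : ContDiff ℂ 2 f) (hg : ContDiff ℂ 2 g)
    (p x a b q w : V) :
    fderiv ℂ (fun r => fderiv ℂ g r a - fderiv ℂ f r b
        + fderiv ℂ f r x * fderiv ℂ g r p - fderiv ℂ f r p * fderiv ℂ g r x) q w =
      fderiv ℂ (fun r => fderiv ℂ g r a) q w - fderiv ℂ (fun r => fderiv ℂ f r b) q w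
        + (fderiv ℂ f q x * fderiv ℂ (fun r => fderiv ℂ g r p) q w
          + fderiv ℂ g q p * fderiv ℂ (fun r => fderiv ℂ f r x) q w)
        - (fderiv ℂ f q p * fderiv ℂ (fun r => fderiv ℂ g r x) q w
          + fderiv ℂ g q x * fderiv ℂ (fun r => fderiv ℂ f r p) q w) := by
  have hf' := fun v => hf.differentiable_fderiv_apply_const v q
  have hg' := fun v => hg.differentiable_fderiv_apply_const v q
  rw [fderiv_fun_sub (((hg' a).fun_sub (hf' b)).fun_add ((hf' x).fun_mul (hg' p)))
      ((hf' p).fun_mul (hg' x)),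
    fderiv_fun_add ((hg' a).fun_sub (hf' b)) ((hf' x).fun_mul (hg' p)),
    fderiv_fun_sub (hg' a) (hf' b), fderiv_fun_mul (hf' p) (hg' x), fderiv_fun_mul (hf' x) (hg' p)]
  simp

/-- A common solution of two Lax-type equations Poisson-commutes with their curvature. -/
theorem bracket_curvature_eq_zero {f g F : V → ℂ} (hf : ContDiff ℂ 2 f) (hg : ContDiff ℂ 2 g)
    (hF : ContDiff ℂ 2 F) (p x a b : V)
    (ha : ∀ r, fderiv ℂ F r a = fderiv ℂ f r p * fderiv ℂ F r x - fderiv ℂ f r x * fderiv ℂ F r p)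
    (hb : ∀ r, fderiv ℂ F r b = fderiv ℂ g r p * fderiv ℂ F r x - fderiv ℂ g r x * fderiv ℂ F r p)
    (q : V) :
    fderiv ℂ (fun r => fderiv ℂ g r a - fderiv ℂ f r b
        + fderiv ℂ f r x * fderiv ℂ g r p - fderiv ℂ f r p * fderiv ℂ g r x) q p * fderiv ℂ F q x
      - fderiv ℂ (fun r => fderiv ℂ g r a - fderiv ℂ f r b
        + fderiv ℂ f r x * fderiv ℂ g r p - fderiv ℂ f r p * fderiv ℂ g r x) q x * fderiv ℂ F q p
      = 0 := by
  have hFa : ∀ w, fderiv ℂ (fun r => fderiv ℂ F r a) q w = _ := fun w => by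
    rw [funext ha, fderiv_bracket_apply hf hF]
  have hFb : ∀ w, fderiv ℂ (fun r => fderiv ℂ F r b) q w = _ := fun w => by
    rw [funext hb, fderiv_bracket_apply hg hF]
  have hab := hF.fderiv_fderiv_apply_comm a b q
  rw [hFa b, hFb a, hF.fderiv_fderiv_apply_comm x b, hF.fderiv_fderiv_apply_comm p b,
    hF.fderiv_fderiv_apply_comm x a, hF.fderiv_fderiv_apply_comm p a,
    hFa p, hFa x, hFb p, hFb x] at hab
  rw [fderiv_curvature_apply hf hg, fderiv_curvature_apply hf hg,
    hg.fderiv_fderiv_apply_comm a p, hg.fderiv_fderiv_apply_comm a x,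
    hf.fderiv_fderiv_apply_comm b p, hf.fderiv_fderiv_apply_comm b x,
    hf.fderiv_fderiv_apply_comm x p, hg.fderiv_fderiv_apply_comm x p]
  rw [hF.fderiv_fderiv_apply_comm x p, hf.fderiv_fderiv_apply_comm x p,
    hg.fderiv_fderiv_apply_comm x p] at hab
  linear_combination -hab

end DirectionalDerivatives

/-- If both `E` and `Q` solve the Lax-type equations and satisfy the string equation
`{Q, E} = 1`, then the Whitham expression `W_{AB}` is constant in the `(p, x)`
directions. -/
theorem whitham_string_constancy {n : ℕ} (hn : 0 < n) (A B : Fin n)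
    (ΩA ΩB E Q : ℂ × (Fin n → ℂ) → ℂ)
    (hΩA : ContDiff ℂ 2 ΩA) (hΩB : ContDiff ℂ 2 ΩB)
    (hE : ContDiff ℂ 2 E) (hQ : ContDiff ℂ 2 Q)
    (hLaxEA : ∀ q : ℂ × (Fin n → ℂ),
      tDeriv A E q = pDeriv ΩA q * tDeriv ⟨0, hn⟩ E q - tDeriv ⟨0, hn⟩ ΩA q * pDeriv E q)
    (hLaxEB : ∀ q : ℂ × (Fin n → ℂ),
      tDeriv B E q = pDeriv ΩB q * tDeriv ⟨0, hn⟩ E q - tDeriv ⟨0, hn⟩ ΩB q * pDeriv E q)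
    (hLaxQA : ∀ q : ℂ × (Fin n → ℂ),
      tDeriv A Q q = pDeriv ΩA q * tDeriv ⟨0, hn⟩ Q q - tDeriv ⟨0, hn⟩ ΩA q * pDeriv Q q)
    (hLaxQB : ∀ q : ℂ × (Fin n → ℂ),
      tDeriv B Q q = pDeriv ΩB q * tDeriv ⟨0, hn⟩ Q q - tDeriv ⟨0, hn⟩ ΩB q * pDeriv Q q)
    (hstring : ∀ q : ℂ × (Fin n → ℂ),
      pDeriv Q q * tDeriv ⟨0, hn⟩ E q - tDeriv ⟨0, hn⟩ Q q * pDeriv E q = 1)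
    (q : ℂ × (Fin n → ℂ)) :
    pDeriv (fun r => tDeriv A ΩB r - tDeriv B ΩA r
        + tDeriv ⟨0, hn⟩ ΩA r * pDeriv ΩB r - pDeriv ΩA r * tDeriv ⟨0, hn⟩ ΩB r) q = 0 ∧
    tDeriv ⟨0, hn⟩ (fun r => tDeriv A ΩB r - tDeriv B ΩA r
        + tDeriv ⟨0, hn⟩ ΩA r * pDeriv ΩB r - pDeriv ΩA r * tDeriv ⟨0, hn⟩ ΩB r) q = 0 := by
  have hWE := bracket_curvature_eq_zero hΩA hΩB hE (1, 0) (0, Pi.single ⟨0, hn⟩ 1)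
    (0, Pi.single A 1) (0, Pi.single B 1) hLaxEA hLaxEB q
  have hWQ := bracket_curvature_eq_zero hΩA hΩB hQ (1, 0) (0, Pi.single ⟨0, hn⟩ 1)
    (0, Pi.single A 1) (0, Pi.single B 1) hLaxQA hLaxQB q
  have hdet := hstring q
  simp only [pDeriv, tDeriv] at hdet ⊢
  set W := fderiv ℂ (fun r => fderiv ℂ ΩB r (0, Pi.single A 1) - fderiv ℂ ΩA r (0, Pi.single B 1)
    + fderiv ℂ ΩA r (0, Pi.single ⟨0, hn⟩ 1) * fderiv ℂ ΩB r (1, 0)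
    - fderiv ℂ ΩA r (1, 0) * fderiv ℂ ΩB r (0, Pi.single ⟨0, hn⟩ 1)) q
  constructor
  · linear_combination (fderiv ℂ Q q (1, 0)) * hWE - (fderiv ℂ E q (1, 0)) * hWQ
      - W (1, 0) * hdet
  · linear_combination (fderiv ℂ Q q (0, Pi.single ⟨0, hn⟩ 1)) * hWE
      - (fderiv ℂ E q (0, Pi.single ⟨0, hn⟩ 1)) * hWQ
      - W (0, Pi.single ⟨0, hn⟩ 1) * hdet
end
end
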